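/- Let (Y(u))_{u∈(0,∞)} be a centred real-valued stochastic process satisfying Conditions (B). Then there exists a modification of Y that is equal in law to σB for some σ ≥ 0, where B is a standard one-dimensional Brownian motion. -/

import Mathlib

open MeasureTheory ProbabilityTheory Filter Set

noncomputable section

/-- The law of a real stochastic process, as a measure on the product space. -/
def processLaw {Ω I : Type*} [MeasurableSpace Ω] (P : Measure Ω) (X : I → Ω → ℝ) :
    Measure (I → ℝ) :=
  Measure.map (fun ω i => X i ω) P

/-- The σ-algebra generated by a real stochastic process. -/
def processSigma {Ω I : Type*} (X : I → Ω → ℝ) : MeasurableSpace Ω :=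
  ⨆ i, MeasurableSpace.comap (X i) inferInstance

/-- Finite dimensional distributions of the process `X` are those of a centred Gaussian
process with covariance kernel `K` (expressed through one-dimensional laws of
arbitrary finite linear combinations). -/
def HasGaussianFDD {Ω : Type*} [MeasurableSpace Ω] (P : Measure Ω) {I : Type*}
    (X : I → Ω → ℝ) (K : I → I → ℝ) : Prop :=
  ∀ (n : ℕ) (idx : Fin n → I) (c : Fin n → ℝ),
    Measure.map (fun ω => ∑ i, c i * X (idx i) ω) P =
      gaussianReal 0 (Real.toNNReal (∑ i, ∑ j, c i * c j * K (idx i) (idx j)))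

/-- Conditions (B) on a centred real stochastic process `(Y(u))_{u ∈ (0,∞)}`:
stochastic continuity, finite moments of some positive order, Brownian scaling,
independence of future increments from the past, and the harness property. -/
structure ConditionsB {Ω : Type*} [MeasurableSpace Ω] (P : Measure Ω) (Y : ℝ → Ω → ℝ) :
    Prop where
  meas : ∀ u : ℝ, 0 < u → Measurable (Y u)
  /-- the process is centred -/
  centred : ∀ u : ℝ, 0 < u → Integrable (Y u) P ∧ ∫ ω, Y u ω ∂P = 0
  /-- (i) stochastic continuity -/
  stochasticContinuity : ∀ u₀ : ℝ, 0 < u₀ →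
    TendstoInMeasure P Y (nhdsWithin u₀ (Ioi 0)) (Y u₀)
  /-- (ii) finite moments of some positive order `ξ` -/
  momentBound : ∃ ξ : ℝ, 0 < ξ ∧ ∀ u : ℝ, 0 < u →
    ∫⁻ ω, ENNReal.ofReal (|Y u ω| ^ ξ) ∂P < ⊤
  /-- (iii) Brownian scaling -/
  scaling : ∀ c : ℝ, 0 < c →
    processLaw P (fun u : {u : ℝ // 0 < u} => Y (c * u.1)) =
      processLaw P (fun u : {u : ℝ // 0 < u} => fun ω => Real.sqrt c * Y u.1 ω)
  /-- (iv) future increments independent of the past -/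
  indepIncrements : ∀ u : ℝ, 0 < u →
    Indep (processSigma fun s : {s : ℝ // u ≤ s} => fun ω => Y s.1 ω - Y u ω)
          (processSigma fun s : {s : ℝ // 0 < s ∧ s ≤ u} => Y s.1) P
  /-- (v) the harness property -/
  harness : ∀ s r : ℝ, 0 < s → s < r →
    Indep (processSigma fun u : {u : ℝ // s < u ∧ u < r} => fun ω =>
            Y u.1 ω - ((u.1 - s) / (r - s) * Y r ω + (r - u.1) / (r - s) * Y s ω))
          ((processSigma fun v : {v : ℝ // 0 < v ∧ v ≤ s} => Y v.1) ⊔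
            processSigma fun v : {v : ℝ // r ≤ v} => Y v.1) P

end

/-- A function with `φ 0 = 1` satisfying the functional equation does not vanish. -/
lemma ne_zero_of_functional_equation {φ : ℝ → ℂ} (hcont : Continuous φ) (h0 : φ 0 = 1)
    (hfun : ∀ l : ℝ, 1 < l → ∀ a b : ℝ,
      φ (a + b) * φ (l * b) * φ (a / l) = φ a * φ b * φ (l * b + a / l)) (x : ℝ) :
    φ x ≠ 0 := by
  have hnhds : ∀ᶠ y in nhds (0 : ℝ), φ y ≠ 0 :=
    hcont.continuousAt.eventually_ne (by simp [h0])
  obtain ⟨ε, hε, hball⟩ := Metric.eventually_nhds_iff.1 hnhds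
  have hgrow : ∀ n : ℕ, ∀ y : ℝ, |y| < (5 / 4) ^ n * ε → φ y ≠ 0 := by
    intro n
    induction n with
    | zero => intro y hy; exact hball (by simpa using hy)
    | succ n ih =>
      intro y hy hzero
      have hsmall : ∀ c : ℝ, 0 ≤ c → c ≤ 4 / 5 → φ (c * y) ≠ 0 := by
        intro c hc hc'
        apply ih
        rw [abs_mul, abs_of_nonneg hc]
        calc c * |y| ≤ 4 / 5 * |y| := by gcongr
          _ < (5 / 4) ^ n * ε := by rw [pow_succ] at hy; linarith
      have h := hfun 2 (by norm_num) (4 / 5 * y) (1 / 5 * y)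
      rw [show 4 / 5 * y + 1 / 5 * y = y by ring, hzero, zero_mul, zero_mul,
        show 2 * (1 / 5 * y) + 4 / 5 * y / 2 = 4 / 5 * y by ring] at h
      exact mul_ne_zero (mul_ne_zero (hsmall _ (by norm_num) (by norm_num))
        (hsmall _ (by norm_num) (by norm_num))) (hsmall _ (by norm_num) (by norm_num)) h.symm
  obtain ⟨n, hn⟩ := pow_unbounded_of_one_lt (|x| / ε) (by norm_num : (1 : ℝ) < 5 / 4)
  exact hgrow n x (by rwa [div_lt_iff₀ hε] at hn)

/-- A differentiable Hermitian function bounded by one, with vanishing derivative at the origin,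
which satisfies the functional equation is a centred Gaussian characteristic function. -/
lemma eq_gaussian_of_functional_equation {φ φ' : ℝ → ℂ} (hderiv : ∀ x, HasDerivAt φ (φ' x) x)
    (h0 : φ 0 = 1) (h0' : φ' 0 = 0) (hneg : ∀ x, φ (-x) = starRingEnd ℂ (φ x))
    (hle : ∀ x, ‖φ x‖ ≤ 1)
    (hfun : ∀ l : ℝ, 1 < l → ∀ a b : ℝ,
      φ (a + b) * φ (l * b) * φ (a / l) = φ a * φ b * φ (l * b + a / l)) :
    ∃ σ : ℝ, 0 ≤ σ ∧ ∀ x : ℝ, φ x = Complex.exp (-(σ ^ 2 * x ^ 2 / 2 : ℝ)) := by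
  have hne := ne_zero_of_functional_equation
    (continuous_iff_continuousAt.2 fun x => (hderiv x).continuousAt) h0 hfun
  set L : ℝ → ℂ := fun x => φ' x / φ x with hL
  have hφ' : ∀ x, φ' x = L x * φ x := fun x => by simp [hL, hne x]
  have hlog : ∀ l : ℝ, 1 < l → ∀ a b : ℝ,
      L (a + b) + L (a / l) / l = L a + L (l * b + a / l) / l := by
    intro l hl a b
    have hl0 : (l : ℂ) ≠ 0 := by exact_mod_cast (by linarith : l ≠ 0)
    have d1 : HasDerivAt (fun a => φ (a + b)) (φ' (a + b)) a := (hderiv (a + b)).comp_add_const a b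
    have d2 : HasDerivAt (fun a => φ (a / l)) (φ' (a / l) / l) a :=
      ((hderiv (a / l)).scomp a ((hasDerivAt_id a).div_const l)).congr_deriv
        (by simp [div_eq_inv_mul])
    have d3 : HasDerivAt (fun a => φ (l * b + a / l)) (φ' (l * b + a / l) / l) a :=
      ((hderiv (l * b + a / l)).scomp a
        (((hasDerivAt_id a).div_const l).const_add (l * b))).congr_deriv
        (by simp [div_eq_inv_mul])
    have hl := (d1.mul_const (φ (l * b))).mul d2
    have hr := ((hderiv a).mul_const (φ b)).mul d3
    have heq := hl.unique (hr.congr_of_eventuallyEq (.of_forall fun a => hfun l ‹_› a b))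
    simp only [hφ'] at heq
    have hprod : φ a * φ b * φ (l * b + a / l) ≠ 0 :=
      mul_ne_zero (mul_ne_zero (hne _) (hne _)) (hne _)
    apply mul_right_cancel₀ hprod
    have hf := hfun l ‹_› a b
    linear_combination heq - (L (a + b) + L (a / l) / l) * hf
  have hL0 : L 0 = 0 := by simp [hL, h0']
  have hscale : ∀ l : ℝ, 1 < l → ∀ x, L (l * x) = l * L x := by
    intro l hl x
    have hl0 : (l : ℂ) ≠ 0 := by exact_mod_cast (by linarith : l ≠ 0)
    have h := hlog l hl 0 x
    simp only [zero_add, zero_div, hL0, add_zero] at h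
    rw [h]; field_simp
  have hodd : ∀ x, L (-x) = -L x := by
    intro x
    have h := hlog 2 (by norm_num) (2 * x) (-x)
    rw [show 2 * x + -x = x by ring, show 2 * x / 2 = x by ring,
      show 2 * -x + x = -x by ring, hscale 2 (by norm_num)] at h
    push_cast at h
    linear_combination (-2) * h
  have hpos : ∀ x : ℝ, 0 < x → L x = x * L 1 := by
    intro x hx
    rcases lt_trichotomy x 1 with h | h | h
    · have := hscale x⁻¹ (one_lt_inv_iff₀.2 ⟨hx, h⟩) x
      have hx0 : (x : ℂ) ≠ 0 := by exact_mod_cast hx.ne'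
      rw [inv_mul_cancel₀ hx.ne'] at this
      rw [this]; push_cast; field_simp
    · simp [h]
    · simpa using hscale x h 1
  have hlin : ∀ x : ℝ, L x = x * L 1 := by
    intro x
    rcases lt_trichotomy x 0 with h | h | h
    · have h1 := hpos (-x) (by linarith)
      rw [hodd] at h1
      push_cast at h1
      linear_combination -h1
    · simp [h, hL0]
    · exact hpos x h
  have hconj : starRingEnd ℂ (L 1) = L 1 := by
    have d1 : HasDerivAt (fun x => φ (-x)) (-φ' (-1)) 1 :=
      ((hderiv (-1)).scomp (1 : ℝ) (hasDerivAt_neg (1 : ℝ))).congr_deriv (by simp)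
    have d2 : HasDerivAt (fun x => starRingEnd ℂ (φ x)) (starRingEnd ℂ (φ' 1)) 1 :=
      (hderiv 1).star
    have h := d1.unique (d2.congr_of_eventuallyEq (.of_forall hneg))
    rw [hφ', hφ', map_mul, hodd, hneg] at h
    apply mul_right_cancel₀ ((map_ne_zero (starRingEnd ℂ)).2 (hne 1))
    linear_combination -h
  obtain ⟨κ, hκ⟩ := Complex.conj_eq_iff_real.1 hconj
  have hsol : ∀ x : ℝ, φ x = Complex.exp ((κ * x ^ 2 / 2 : ℝ)) := by
    have hd : ∀ x : ℝ, HasDerivAt (fun x : ℝ => φ x * Complex.exp (-((κ * x ^ 2 / 2 : ℝ) : ℂ)))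
        0 x := by
      intro x
      have h1 : HasDerivAt (fun x : ℝ => κ * x ^ 2 / 2) (κ * x) x :=
        ((((hasDerivAt_id x).pow 2).const_mul κ).div_const 2).congr_deriv (by simp; ring)
      refine ((hderiv x).mul h1.ofReal_comp.neg.cexp).congr_deriv ?_
      rw [hφ', hlin, hκ]; push_cast; ring
    intro x
    have h := is_const_of_deriv_eq_zero (fun x => (hd x).differentiableAt)
      (fun x => (hd x).deriv) x 0
    simp only [h0, ne_eq, OfNat.ofNat_ne_zero, not_false_eq_true, zero_pow, mul_zero, zero_div,
      Complex.ofReal_zero, neg_zero, Complex.exp_zero, mul_one, Complex.exp_neg] at h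
    field_simp at h
    exact h
  have hκ0 : κ ≤ 0 := by
    have h := hle 1
    rw [hsol, Complex.norm_exp_ofReal, Real.exp_le_one_iff] at h
    linarith
  refine ⟨√(-κ), Real.sqrt_nonneg _, fun x => ?_⟩
  rw [hsol, Real.sq_sqrt (by linarith)]
  congr 1
  push_cast; ring

/-- The expectation of `exp (i X)`. -/
noncomputable def expI {Ω : Type*} [MeasurableSpace Ω] (P : Measure Ω) (X : Ω → ℝ) : ℂ :=
  ∫ ω, Complex.exp (X ω * Complex.I) ∂P

section ExpI

variable {Ω : Type*} [MeasurableSpace Ω] {P : Measure Ω}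

lemma charFun_map_eq_expI {X : Ω → ℝ} (hX : Measurable X) (t : ℝ) :
    charFun (P.map X) t = expI P (fun ω => t * X ω) := by
  rw [charFun_apply_real, integral_map hX.aemeasurable (by fun_prop)]
  simp [expI]

lemma expI_add_of_indepFun [IsFiniteMeasure P] {X Z : Ω → ℝ} (hX : Measurable X) (hZ : Measurable Z)
    (h : IndepFun X Z P) : expI P (fun ω => X ω + Z ω) = expI P X * expI P Z := by
  have key := congrFun (h.charFun_map_fun_add_eq_mul hX.aemeasurable hZ.aemeasurable) 1
  rw [Pi.mul_apply, charFun_map_eq_expI (X := fun ω => X ω + Z ω) (hX.add hZ),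
    charFun_map_eq_expI hX, charFun_map_eq_expI hZ] at key
  simpa using key

lemma integrable_cexp_mul_I [IsFiniteMeasure P] {X : Ω → ℝ} (hX : Measurable X) :
    Integrable (fun ω => Complex.exp (X ω * Complex.I)) P := by
  refine Integrable.of_bound (by fun_prop) 1 (.of_forall fun ω => ?_)
  rw [Complex.norm_exp_ofReal_mul_I]

lemma norm_expI_le_one [IsProbabilityMeasure P] {X : Ω → ℝ} (hX : Measurable X) :
    ‖expI P X‖ ≤ 1 := by
  simpa [charFun_map_eq_expI hX] using
    (norm_charFun_le (μ := P.map X) 1).trans (measureReal_le_one (μ := P.map X))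

lemma norm_expI_sub_expI_le [IsFiniteMeasure P] {X Z : Ω → ℝ} (hX : Measurable X)
    (hZ : Measurable Z) (hXZ : Integrable (fun ω => X ω - Z ω) P) :
    ‖expI P X - expI P Z‖ ≤ ∫ ω, |X ω - Z ω| ∂P := by
  rw [expI, expI, ← integral_sub (integrable_cexp_mul_I hX) (integrable_cexp_mul_I hZ)]
  refine norm_integral_le_of_norm_le hXZ.abs (.of_forall fun ω => ?_)
  have h : Complex.exp (X ω * Complex.I) - Complex.exp (Z ω * Complex.I) =
      Complex.exp (Z ω * Complex.I) * (Complex.exp (Complex.I * (X ω - Z ω : ℝ)) - 1) := by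
    rw [mul_sub, ← Complex.exp_add, mul_one]
    congr 2
    push_cast; ring
  rw [h, norm_mul, Complex.norm_exp_ofReal_mul_I, one_mul]
  exact Real.norm_exp_I_mul_ofReal_sub_one_le

end ExpI

lemma measurable_processSigma {Ω I : Type*} (X : I → Ω → ℝ) (i : I) :
    Measurable[processSigma X] (X i) :=
  Measurable.of_comap_le (le_iSup (fun i => MeasurableSpace.comap (X i) inferInstance) i)

lemma indepFun_of_indep {Ω : Type*} [MeasurableSpace Ω] {P : Measure Ω}
    {m₁ m₂ : MeasurableSpace Ω} (h : Indep m₁ m₂ P) {f g : Ω → ℝ} (hf : Measurable[m₁] f)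
    (hg : Measurable[m₂] g) : IndepFun f g P :=
  indep_of_indep_of_le_left (indep_of_indep_of_le_right h hg.comap_le) hf.comap_le

namespace ConditionsB

variable {Ω : Type*} [MeasurableSpace Ω] {P : Measure Ω} {Y : ℝ → Ω → ℝ}

lemma expI_add_increment [IsFiniteMeasure P] (hY : ConditionsB P Y) {u T : ℝ} (hu : 0 < u)
    (hT : u ≤ T) {X : Ω → ℝ}
    (hX : Measurable[processSigma fun s : {s : ℝ // 0 < s ∧ s ≤ u} => Y s.1] X)
    (hX' : Measurable X) (d : ℝ) :
    expI P (fun ω => X ω + d * (Y T ω - Y u ω)) =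
      expI P X * expI P (fun ω => d * (Y T ω - Y u ω)) := by
  refine expI_add_of_indepFun hX'
    (((hY.meas T (hu.trans_le hT)).sub (hY.meas u hu)).const_mul d)
    (indepFun_of_indep (hY.indepIncrements u hu).symm hX ?_)
  exact (measurable_processSigma (fun s : {s : ℝ // u ≤ s} => fun ω => Y s.1 ω - Y u ω)
    ⟨T, hT⟩).const_mul d

lemma expI_add_harness [IsFiniteMeasure P] (hY : ConditionsB P Y) {s u r : ℝ} (hs : 0 < s)
    (hsu : s < u) (hur : u < r) (a b : ℝ) :
    expI P (fun ω => a * (Y u ω - ((u - s) / (r - s) * Y r ω + (r - u) / (r - s) * Y s ω))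
        + b * Y r ω) =
      expI P (fun ω => a * (Y u ω - ((u - s) / (r - s) * Y r ω + (r - u) / (r - s) * Y s ω))) *
        expI P (fun ω => b * Y r ω) := by
  have ms := hY.meas s hs
  have mu := hY.meas u (hs.trans hsu)
  have mr := hY.meas r (hs.trans (hsu.trans hur))
  refine expI_add_of_indepFun (by fun_prop) (by fun_prop)
    (indepFun_of_indep (hY.harness s r hs (hsu.trans hur)) ?_ ?_)
  · exact (measurable_processSigma (fun u : {u : ℝ // s < u ∧ u < r} => fun ω =>
      Y u.1 ω - ((u.1 - s) / (r - s) * Y r ω + (r - u.1) / (r - s) * Y s ω))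
      ⟨u, hsu, hur⟩).const_mul a
  · exact ((measurable_processSigma (fun v : {v : ℝ // r ≤ v} => Y v.1)
      ⟨r, le_rfl⟩).mono le_sup_right le_rfl).const_mul b

lemma map_scaling (hY : ConditionsB P Y) {c : ℝ} (hc : 0 < c) :
    P.map (Y c) = P.map (fun ω => √c * Y 1 ω) := by
  have h := congrArg (Measure.map (fun f : {u : ℝ // 0 < u} → ℝ => f ⟨1, one_pos⟩))
    (hY.scaling c hc)
  have hm := hY.meas
  unfold processLaw at h
  rw [Measure.map_map (by fun_prop) (measurable_pi_lambda _ fun u => hm _ (mul_pos hc u.2)),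
    Measure.map_map (by fun_prop) (measurable_pi_lambda _ fun u => (hm _ u.2).const_mul _)] at h
  simpa [Function.comp_def] using h

lemma expI_scaling (hY : ConditionsB P Y) {c : ℝ} (hc : 0 < c) (t : ℝ) :
    expI P (fun ω => t * Y c ω) = charFun (P.map (Y 1)) (√c * t) := by
  rw [← charFun_map_eq_expI (hY.meas c hc), hY.map_scaling hc,
    charFun_map_eq_expI ((hY.meas 1 one_pos).const_mul _),
    charFun_map_eq_expI (hY.meas 1 one_pos)]
  congr 1; ext ω; ring

lemma integral_abs_scaling (hY : ConditionsB P Y) {c : ℝ} (hc : 0 < c) :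
    ∫ ω, |Y c ω| ∂P = √c * ∫ ω, |Y 1 ω| ∂P := by
  have h : ∫ x, |x| ∂(P.map (Y c)) = ∫ x, |x| ∂(P.map (fun ω => √c * Y 1 ω)) := by
    rw [hY.map_scaling hc]
  rw [integral_map (hY.meas c hc).aemeasurable (by fun_prop),
    integral_map ((hY.meas 1 one_pos).const_mul _).aemeasurable (by fun_prop)] at h
  rw [h, ← integral_const_mul]
  simp only [abs_mul, abs_of_nonneg (Real.sqrt_nonneg c)]

lemma tendsto_expI_bridge [IsFiniteMeasure P] (hY : ConditionsB P Y) {u r : ℝ} (hu : 0 < u)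
    (hur : u < r) (a b : ℝ) :
    Tendsto (fun s => expI P (fun ω =>
        a * (Y u ω - ((u - s) / (r - s) * Y r ω + (r - u) / (r - s) * Y s ω)) + b * Y r ω))
      (nhdsWithin 0 (Ioi 0)) (nhds (expI P (fun ω => a * (Y u ω - u / r * Y r ω) + b * Y r ω))) := by
  have hr : 0 < r := hu.trans hur
  have mu := hY.meas u hu
  have mr := hY.meas r hr
  have ir := (hY.centred r hr).1
  set C : ℝ → ℝ := fun s => |a| * (|u / r - (u - s) / (r - s)| * ∫ ω, |Y r ω| ∂P +
    |(r - u) / (r - s)| * (√s * ∫ ω, |Y 1 ω| ∂P)) with hC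
  have hC0 : Tendsto C (nhdsWithin 0 (Ioi 0)) (nhds 0) := by
    have hcont : ContinuousAt C 0 := by
      have : (r - 0 : ℝ) ≠ 0 := by simpa using hr.ne'
      simp only [hC]
      fun_prop (disch := assumption)
    have h := hcont.tendsto.mono_left (nhdsWithin_le_nhds (s := Ioi 0))
    simpa [hC] using h
  rw [tendsto_iff_norm_sub_tendsto_zero]
  refine squeeze_zero' (.of_forall fun s => norm_nonneg _) ?_ hC0
  filter_upwards [self_mem_nhdsWithin] with s hs
  have ms := hY.meas s hs
  have is := (hY.centred s hs).1
  have hdiff : (fun ω => (a * (Y u ω - ((u - s) / (r - s) * Y r ω + (r - u) / (r - s) * Y s ω))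
      + b * Y r ω) - (a * (Y u ω - u / r * Y r ω) + b * Y r ω)) =
      fun ω => a * ((u / r - (u - s) / (r - s)) * Y r ω - (r - u) / (r - s) * Y s ω) := by
    ext ω; ring
  have hint : Integrable (fun ω => a * ((u / r - (u - s) / (r - s)) * Y r ω -
      (r - u) / (r - s) * Y s ω)) P :=
    ((ir.const_mul _).sub (is.const_mul _)).const_mul a
  refine (norm_expI_sub_expI_le (by fun_prop) (by fun_prop) (hdiff ▸ hint)).trans ?_
  have hint' : Integrable (fun ω => |a| * (|u / r - (u - s) / (r - s)| * |Y r ω| +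
      |(r - u) / (r - s)| * |Y s ω|)) P :=
    ((ir.abs.const_mul _).add (is.abs.const_mul _)).const_mul _
  calc ∫ ω, |(a * (Y u ω - ((u - s) / (r - s) * Y r ω + (r - u) / (r - s) * Y s ω))
      + b * Y r ω) - (a * (Y u ω - u / r * Y r ω) + b * Y r ω)| ∂P
      ≤ ∫ ω, |a| * (|u / r - (u - s) / (r - s)| * |Y r ω| +
        |(r - u) / (r - s)| * |Y s ω|) ∂P := by
        refine integral_mono (hdiff ▸ hint).abs hint' fun ω => ?_
        simp only [congrFun hdiff ω, abs_mul]
        gcongr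
        refine (abs_sub _ _).trans ?_
        simp only [abs_mul, le_refl]
    _ = C s := by
        rw [integral_const_mul, integral_add (ir.abs.const_mul _) (is.abs.const_mul _),
          integral_const_mul, integral_const_mul, hY.integral_abs_scaling hs]

lemma expI_add_harness_zero [IsProbabilityMeasure P] (hY : ConditionsB P Y) {u r : ℝ} (hu : 0 < u)
    (hur : u < r) (a b : ℝ) :
    expI P (fun ω => a * (Y u ω - u / r * Y r ω) + b * Y r ω) =
      expI P (fun ω => a * (Y u ω - u / r * Y r ω)) * expI P (fun ω => b * Y r ω) := by
  have h0 := hY.tendsto_expI_bridge hu hur a 0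
  simp only [zero_mul, add_zero] at h0
  refine tendsto_nhds_unique (hY.tendsto_expI_bridge hu hur a b)
    ((h0.mul_const (expI P (fun ω => b * Y r ω))).congr' ?_)
  filter_upwards [Ioo_mem_nhdsGT hu] with s hs
  exact (hY.expI_add_harness hs.1 hs.2 hur a b).symm

lemma expI_pair_eq_increment [IsFiniteMeasure P] (hY : ConditionsB P Y) {u r : ℝ} (hu : 0 < u)
    (hur : u ≤ r) (a b : ℝ) :
    expI P (fun ω => a * Y u ω + b * Y r ω) =
      charFun (P.map (Y 1)) (√u * (a + b)) * expI P (fun ω => b * (Y r ω - Y u ω)) := by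
  rw [← hY.expI_scaling hu, ← hY.expI_add_increment hu hur
    ((measurable_processSigma (fun s : {s : ℝ // 0 < s ∧ s ≤ u} => Y s.1)
      ⟨u, hu, le_rfl⟩).const_mul _) ((hY.meas u hu).const_mul _)]
  congr 1; ext ω; ring

lemma expI_pair_eq_bridge [IsProbabilityMeasure P] (hY : ConditionsB P Y) {u r : ℝ} (hu : 0 < u)
    (hur : u < r) (a b : ℝ) :
    expI P (fun ω => a * Y u ω + b * Y r ω) =
      expI P (fun ω => a * (Y u ω - u / r * Y r ω)) *
        charFun (P.map (Y 1)) (√r * (b + a * (u / r))) := by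
  rw [← hY.expI_scaling (hu.trans hur), ← hY.expI_add_harness_zero hu hur]
  congr 1; ext ω; ring

lemma charFun_functional_equation [IsProbabilityMeasure P] (hY : ConditionsB P Y) {l : ℝ}
    (hl : 1 < l) (a b : ℝ) :
    charFun (P.map (Y 1)) (a + b) * charFun (P.map (Y 1)) (l * b) * charFun (P.map (Y 1)) (a / l) =
      charFun (P.map (Y 1)) a * charFun (P.map (Y 1)) b *
        charFun (P.map (Y 1)) (l * b + a / l) := by
  have hl0 : 0 < l := by linarith
  have hl2 : 1 < l ^ 2 := by nlinarith
  have key := fun a b => (hY.expI_pair_eq_increment one_pos hl2.le a b).symm.trans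
    (hY.expI_pair_eq_bridge one_pos hl2 a b)
  have hone : expI P (fun _ => 0) = 1 := by simp [expI]
  have hab := key a b
  have ha := key a 0
  have hb := key 0 b
  have e1 : l * (b + a * (1 / l ^ 2)) = l * b + a / l := by field_simp
  have e2 : l * (a * (1 / l ^ 2)) = a / l := by field_simp
  simp only [Real.sqrt_one, one_mul, Real.sqrt_sq hl0.le, zero_mul, add_zero, zero_add, hone,
    mul_one, e1, e2] at hab ha hb
  rw [← hb, ha]
  linear_combination (charFun (P.map (Y 1)) b * charFun (P.map (Y 1)) (a / l)) * hab

lemma exists_charFun_eq [IsProbabilityMeasure P] (hY : ConditionsB P Y) :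
    ∃ σ : ℝ, 0 ≤ σ ∧ ∀ x : ℝ,
      charFun (P.map (Y 1)) x = Complex.exp (-(σ ^ 2 * x ^ 2 / 2 : ℝ)) := by
  have m1 := hY.meas 1 one_pos
  have : IsProbabilityMeasure (P.map (Y 1)) := Measure.isProbabilityMeasure_map m1.aemeasurable
  have hLp : MemLp id (1 : ℕ) (P.map (Y 1)) := by
    rw [Nat.cast_one, memLp_one_iff_integrable, integrable_map_measure (by fun_prop) m1.aemeasurable]
    exact (hY.centred 1 one_pos).1
  refine eq_gaussian_of_functional_equation (φ' := deriv (charFun (P.map (Y 1))))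
    (fun x => ((contDiff_charFun hLp).differentiable (by simp) x).hasDerivAt) (by simp) ?_
    charFun_neg norm_charFun_le_one fun l hl a b => hY.charFun_functional_equation hl a b
  rw [← iteratedDeriv_one, iteratedDeriv_charFun_zero hLp]
  have hmean : ∫ x, x ∂(P.map (Y 1)) = 0 := by
    rw [integral_map m1.aemeasurable (by fun_prop), (hY.centred 1 one_pos).2]
  simp [hmean]

/-- If `Y 1` is Gaussian, then so are the finite linear combinations of the `Y u`. -/
lemma expI_sum [IsProbabilityMeasure P] (hY : ConditionsB P Y) {σ : ℝ}
    (hσ : ∀ x : ℝ, charFun (P.map (Y 1)) x = Complex.exp (-(σ ^ 2 * x ^ 2 / 2 : ℝ)))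
    {ι : Type*} [DecidableEq ι] (idx : ι → ℝ) (hidx : ∀ i, 0 < idx i) (c : ι → ℝ) (S : Finset ι) :
    ∀ T : ℝ, 0 < T → (∀ i ∈ S, idx i ≤ T) → ∀ d : ℝ,
    expI P (fun ω => ∑ i ∈ S, c i * Y (idx i) ω + d * Y T ω) =
      Complex.exp (-(σ ^ 2 / 2 * (∑ i ∈ S, ∑ j ∈ S, c i * c j * min (idx i) (idx j) +
        2 * d * ∑ i ∈ S, c i * idx i + d ^ 2 * T) : ℝ)) := by
  induction S using Finset.induction_on_max_value idx with
  | empty =>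
    intro T hT _ d
    simp only [Finset.sum_empty, zero_add, mul_zero]
    rw [hY.expI_scaling hT, hσ, mul_pow, Real.sq_sqrt hT.le]
    congr 3; ring
  | insert a S haS hmax ih =>
    intro T hT hST d
    have ha := hidx a
    have haT : idx a ≤ T := hST a (Finset.mem_insert_self _ _)
    have hincr : expI P (fun ω => d * (Y T ω - Y (idx a) ω)) =
        Complex.exp (-(σ ^ 2 / 2 * (d ^ 2 * (T - idx a)) : ℝ)) := by
      have h := hY.expI_pair_eq_increment ha haT 0 d
      simp only [zero_mul, zero_add] at h
      rw [hY.expI_scaling hT, hσ, hσ] at h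
      apply mul_left_cancel₀ (Complex.exp_ne_zero (-(σ ^ 2 * (√(idx a) * d) ^ 2 / 2 : ℝ)))
      rw [← h, ← Complex.exp_add, mul_pow, mul_pow, Real.sq_sqrt hT.le, Real.sq_sqrt ha.le]
      congr 1; push_cast; ring
    have hrw : (fun ω => ∑ i ∈ insert a S, c i * Y (idx i) ω + d * Y T ω) =
        fun ω => (∑ i ∈ S, c i * Y (idx i) ω + (c a + d) * Y (idx a) ω) +
          d * (Y T ω - Y (idx a) ω) := by
      ext ω; rw [Finset.sum_insert haS]; ring
    have hpast : ∀ i, idx i ≤ idx a → Measurable[processSigma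
        fun s : {s : ℝ // 0 < s ∧ s ≤ idx a} => Y s.1] (Y (idx i)) := fun i hi =>
      measurable_processSigma (fun s : {s : ℝ // 0 < s ∧ s ≤ idx a} => Y s.1) ⟨idx i, hidx i, hi⟩
    have hm : ∀ i, Measurable (Y (idx i)) := fun i => hY.meas _ (hidx i)
    rw [hrw, hY.expI_add_increment (X := fun ω => ∑ i ∈ S, c i * Y (idx i) ω +
      (c a + d) * Y (idx a) ω) ha haT
      ((Finset.measurable_fun_sum S fun i hi => (hpast i (hmax i hi)).const_mul _).add
        ((hpast a le_rfl).const_mul _)) (by fun_prop), ih (idx a) ha hmax (c a + d), hincr,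
      ← Complex.exp_add]
    have hrow : ∀ i ∈ S, ∑ j ∈ insert a S, c i * c j * min (idx i) (idx j) =
        c a * (c i * idx i) + ∑ j ∈ S, c i * c j * min (idx i) (idx j) := by
      intro i hi
      rw [Finset.sum_insert haS, min_eq_left (hmax i hi)]; ring
    have hcol : ∑ j ∈ S, c a * c j * min (idx a) (idx j) = c a * ∑ j ∈ S, c j * idx j := by
      rw [Finset.mul_sum]
      refine Finset.sum_congr rfl fun j hj => ?_
      rw [min_eq_right (hmax j hj)]; ring
    rw [Finset.sum_insert haS, Finset.sum_insert haS, Finset.sum_insert haS,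
      Finset.sum_congr rfl hrow, hcol, Finset.sum_add_distrib, ← Finset.mul_sum, min_self]
    congr 1; push_cast; ring

lemma expI_fin_sum [IsProbabilityMeasure P] (hY : ConditionsB P Y) {σ : ℝ}
    (hσ : ∀ x : ℝ, charFun (P.map (Y 1)) x = Complex.exp (-(σ ^ 2 * x ^ 2 / 2 : ℝ)))
    {n : ℕ} (idx : Fin n → {u : ℝ // 0 < u}) (c : Fin n → ℝ) :
    expI P (fun ω => ∑ i, c i * Y (idx i).1 ω) =
      Complex.exp (-((∑ i, ∑ j, c i * c j * (σ ^ 2 * min (idx i).1 (idx j).1)) / 2 : ℝ)) := by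
  have hsum : ∀ i, (idx i).1 ≤ ∑ j, (idx j).1 := fun i =>
    Finset.single_le_sum (f := fun j => (idx j).1) (fun j _ => (idx j).2.le) (Finset.mem_univ i)
  have h := hY.expI_sum hσ (fun i => (idx i).1) (fun i => (idx i).2) c Finset.univ
    (1 + ∑ j, (idx j).1) (by linarith [Finset.sum_nonneg fun j (_ : j ∈ Finset.univ) => (idx j).2.le])
    (fun i _ => by linarith [hsum i]) 0
  simp only [zero_mul, add_zero, mul_zero, ne_eq, OfNat.ofNat_ne_zero, not_false_eq_true,
    zero_pow] at h
  have hquad : σ ^ 2 / 2 * ∑ i, ∑ j, c i * c j * min (idx i).1 (idx j).1 =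
      (∑ i, ∑ j, c i * c j * (σ ^ 2 * min (idx i).1 (idx j).1)) / 2 := by
    rw [div_mul_eq_mul_div, Finset.mul_sum]
    simp only [Finset.mul_sum]
    congr 1
    exact Finset.sum_congr rfl fun i _ => Finset.sum_congr rfl fun j _ => by ring
  rw [h, hquad]

end ConditionsB

/-- **Proposition (a characterisation of Brownian motion).** If the centred process
`(Y(u))_{u∈(0,∞)}` satisfies Conditions (B), then there is a modification of `Y` that is
equal in law to `σB` for some `σ ≥ 0`, where `B` is a standard one-dimensional Brownian
motion (equality in law of processes, i.e. the finite dimensional distributions are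
centred Gaussian with covariance `σ² (u ∧ v)`). -/
theorem brownian_characterisation {Ω : Type*} [MeasurableSpace Ω] (P : Measure Ω)
    [IsProbabilityMeasure P] (Y : ℝ → Ω → ℝ) (hY : ConditionsB P Y) :
    ∃ σ : ℝ, 0 ≤ σ ∧ ∃ Z : ℝ → Ω → ℝ,
      (∀ u : ℝ, 0 < u → Z u =ᵐ[P] Y u) ∧
      HasGaussianFDD P (fun u : {u : ℝ // 0 < u} => Z u.1)
        (fun u v => σ ^ 2 * min u.1 v.1) := by
  obtain ⟨σ, hσ0, hσ⟩ := hY.exists_charFun_eq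
  refine ⟨σ, hσ0, Y, fun _ _ => Filter.EventuallyEq.rfl, fun n idx c => ?_⟩
  have hm : ∀ i, Measurable (Y (idx i).1) := fun i => hY.meas _ (idx i).2
  have hmeas : Measurable fun ω => ∑ i, c i * Y (idx i).1 ω := by fun_prop
  have : IsProbabilityMeasure (P.map fun ω => ∑ i, c i * Y (idx i).1 ω) :=
    Measure.isProbabilityMeasure_map hmeas.aemeasurable
  have hnonneg : 0 ≤ ∑ i, ∑ j, c i * c j * (σ ^ 2 * min (idx i).1 (idx j).1) := by
    have h := norm_expI_le_one (P := P) hmeas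
    rw [hY.expI_fin_sum hσ, ← Complex.ofReal_neg, Complex.norm_exp_ofReal,
      Real.exp_le_one_iff] at h
    linarith
  refine Measure.ext_of_charFun (funext fun t => ?_)
  rw [charFun_map_eq_expI hmeas, charFun_gaussianReal, Real.coe_toNNReal _ hnonneg]
  simp only [Finset.mul_sum, ← mul_assoc]
  rw [hY.expI_fin_sum hσ idx fun i => t * c i]
  congr 1
  have hscale : ∑ i, ∑ j, t * c i * (t * c j) * (σ ^ 2 * min (idx i).1 (idx j).1) =
      (∑ i, ∑ j, c i * c j * (σ ^ 2 * min (idx i).1 (idx j).1)) * t ^ 2 := by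
    simp only [Finset.sum_mul]
    exact Finset.sum_congr rfl fun i _ => Finset.sum_congr rfl fun j _ => by ring
  rw [hscale]
  simp only [mul_assoc]
  generalize (∑ i, ∑ j, c i * (c j * (σ ^ 2 * min (idx i).1 (idx j).1))) = q
  push_cast
  ring
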